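/- Let h : ℝ^d → ℝ be α-Hölder for some α ∈ (0,1], let Z ~ N(0, I_d), h̄ = h − E h(Z), and f_h(x) = −∫₀¹ (1/(2t)) E[ h̄(√t x + √(1−t) Z) ] dt. Then f_h solves the multivariate Stein equation: for all x ∈ ℝ^d, Δf_h(x) − x · ∇f_h(x) = h(x) − E h(Z). -/

import Mathlib

open MeasureTheory ProbabilityTheory Real Filter Set

noncomputable section

/-- The standard Gaussian measure `N(0, I_d)` on `ℝ^d` (as `EuclideanSpace ℝ (Fin d)`). -/
def stdGaussian (d : ℕ) : Measure (EuclideanSpace ℝ (Fin d)) :=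
  (Measure.pi fun _ : Fin d => gaussianReal 0 1).map
    ⇑(EuclideanSpace.equiv (Fin d) ℝ).symm

/-- Partial derivative in the `j`-th coordinate direction. -/
def pderivI {d : ℕ} (j : Fin d) (f : EuclideanSpace ℝ (Fin d) → ℝ) :
    EuclideanSpace ℝ (Fin d) → ℝ :=
  fun x => fderiv ℝ f x (EuclideanSpace.single j 1)

/-- Iterated partial derivative along a list of coordinate directions (head applied last,
i.e. outermost). -/
def pderivList {d : ℕ} : List (Fin d) → (EuclideanSpace ℝ (Fin d) → ℝ) →
    EuclideanSpace ℝ (Fin d) → ℝ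
  | [], f => f
  | j :: l, f => pderivI j (pderivList l f)

/-- Multi-index partial derivative `∂^{|m|}/(∂x₁^{m₁} ⋯ ∂x_d^{m_d})`. -/
def pderivMulti {d : ℕ} (m : Fin d → ℕ) (f : EuclideanSpace ℝ (Fin d) → ℝ) :
    EuclideanSpace ℝ (Fin d) → ℝ :=
  pderivList ((List.finRange d).flatMap fun j => List.replicate (m j) j) f

/-- Multivariate Hermite polynomial
`H_m(x) = (-1)^{|m|} e^{|x|²/2} ∂^{|m|}/(∂x₁^{m₁} ⋯ ∂x_d^{m_d}) e^{-|x|²/2}`. -/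
def hermiteMulti {d : ℕ} (m : Fin d → ℕ) (x : EuclideanSpace ℝ (Fin d)) : ℝ :=
  (-1 : ℝ) ^ (∑ j, m j) * Real.exp (‖x‖ ^ 2 / 2) *
    pderivMulti m (fun y => Real.exp (-‖y‖ ^ 2 / 2)) x

/-- `h̄ = h - E h(Z)` with `Z ~ N(0, I_d)`. -/
def hbar (d : ℕ) (h : EuclideanSpace ℝ (Fin d) → ℝ) (x : EuclideanSpace ℝ (Fin d)) : ℝ :=
  h x - ∫ z, h z ∂(stdGaussian d)

/-- Barbour's solution `f_h(x) = -∫₀¹ (1/(2t)) E[ h̄(√t x + √(1-t) Z) ] dt` of the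
multivariate Stein equation. -/
def steinSol (d : ℕ) (h : EuclideanSpace ℝ (Fin d) → ℝ) (x : EuclideanSpace ℝ (Fin d)) : ℝ :=
  -∫ t in Ioo (0 : ℝ) 1,
      (1 / (2 * t)) *
        ∫ z, hbar d h (Real.sqrt t • x + Real.sqrt (1 - t) • z) ∂(stdGaussian d)

/-- Entry `(i, j)` of the Hessian matrix of `f` at `x`. -/
def hessEntry {d : ℕ} (f : EuclideanSpace ℝ (Fin d) → ℝ) (x : EuclideanSpace ℝ (Fin d))
    (i j : Fin d) : ℝ :=
  pderivI i (pderivI j f) x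

/-- The Hessian matrix `∇² f(x)`. -/
def hessMatrix {d : ℕ} (f : EuclideanSpace ℝ (Fin d) → ℝ) (x : EuclideanSpace ℝ (Fin d)) :
    Matrix (Fin d) (Fin d) ℝ :=
  Matrix.of fun i j => hessEntry f x i j

/-- Operator norm `‖M‖_op = sup_{|v| = 1} |M v|` (Euclidean norms) of a `d × d` matrix. -/
def matOpNorm {d : ℕ} (M : Matrix (Fin d) (Fin d) ℝ) : ℝ :=
  sSup { r | ∃ v : EuclideanSpace ℝ (Fin d), ‖v‖ = 1 ∧
    r = ‖(WithLp.equiv 2 (Fin d → ℝ)).symm (M.mulVec ((WithLp.equiv 2 (Fin d → ℝ)) v))‖ }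

/-- The Laplacian `Δ f(x) = ∑ i ∂²f/∂x_i²(x)`. -/
def laplacian {d : ℕ} (f : EuclideanSpace ℝ (Fin d) → ℝ) (x : EuclideanSpace ℝ (Fin d)) : ℝ :=
  ∑ i, hessEntry f x i i

/-- `C` is an `α`-Hölder constant for `h`. -/
def HolderConst {d : ℕ} (α C : ℝ) (h : EuclideanSpace ℝ (Fin d) → ℝ) : Prop :=
  ∀ x y, |h x - h y| ≤ C * dist x y ^ α

/-- The 1-Wasserstein distance in dual form: sup over 1-Lipschitz test functions. -/
def wasserstein1 {d : ℕ} (μ ν : Measure (EuclideanSpace ℝ (Fin d))) : ℝ :=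
  sSup { r | ∃ h : EuclideanSpace ℝ (Fin d) → ℝ, LipschitzWith 1 h ∧
    r = (∫ x, h x ∂μ) - ∫ x, h x ∂ν }

/-- The `α`-Wasserstein distance: sup over continuous `h` with `[h]_α ≤ 1`. -/
def wassersteinHolder {d : ℕ} (α : ℝ) (μ ν : Measure (EuclideanSpace ℝ (Fin d))) : ℝ :=
  sSup { r | ∃ h : EuclideanSpace ℝ (Fin d) → ℝ, Continuous h ∧ HolderConst α 1 h ∧
    r = (∫ x, h x ∂μ) - ∫ x, h x ∂ν }

/-- The constant `C₁(α, d)`. -/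
def C1 (α : ℝ) (d : ℕ) : ℝ :=
  2 ^ (α / 2 + 1) * ((α + 2 * d) / (α * d)) * Real.Gamma ((α + d) / 2) / Real.Gamma (d / 2)

/-- The constant `C₂(α, d)`. -/
def C2 (α : ℝ) (d : ℕ) : ℝ :=
  if α = 1 then 2 * Real.sqrt (2 / π) * Real.sqrt d
  else 2 ^ (α / 2 + 1) * (α + 2 * d) * Real.Gamma ((α + d) / 2) / (α * Real.Gamma (d / 2))

end

section GaussianDecay

variable {V : Type*} [NormedAddCommGroup V]
variable {F : Type*} [NormedAddCommGroup F] {G : Type*} [NormedAddCommGroup G]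

/-- A function with pointwise Gaussian decay at infinity. -/
def GaussDecay (q : V → F) : Prop :=
  ∃ C c : ℝ, 0 ≤ C ∧ 0 < c ∧ ∀ z, ‖q z‖ ≤ C * Real.exp (-c * ‖z‖ ^ 2)

lemma one_add_mul_exp_neg_sq_le {c : ℝ} (hc : 0 < c) (s : ℝ) :
    (1 + s) * Real.exp (-c * s ^ 2) ≤ (2 + 2 / c) * Real.exp (-(c / 2) * s ^ 2) := by
  have h1 : 1 + s ≤ (2 + 2 / c) * Real.exp (c / 2 * s ^ 2) := by
    have h2 := Real.add_one_le_exp (c / 2 * s ^ 2)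
    have h3 : (2 + 2 / c) * (c / 2 * s ^ 2 + 1) = 2 + 2 / c + c * s ^ 2 + s ^ 2 := by
      field_simp; ring
    have h4 : (2 + 2 / c) * (c / 2 * s ^ 2 + 1) ≤ (2 + 2 / c) * Real.exp (c / 2 * s ^ 2) := by
      gcongr
    have h5 : 0 ≤ 2 / c := by positivity
    have h6 : 0 ≤ c * s ^ 2 := by positivity
    nlinarith [sq_nonneg (s - 1)]
  calc (1 + s) * Real.exp (-c * s ^ 2)
      ≤ ((2 + 2 / c) * Real.exp (c / 2 * s ^ 2)) * Real.exp (-c * s ^ 2) := by gcongr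
    _ = (2 + 2 / c) * Real.exp (-(c / 2) * s ^ 2) := by
        rw [mul_assoc, ← Real.exp_add]; ring_nf

lemma GaussDecay.of_norm_le {q : V → F} {p : V → G} (hp : GaussDecay p) {K : ℝ}
    (h : ∀ z, ‖q z‖ ≤ K * ((1 + ‖z‖) * ‖p z‖)) : GaussDecay q := by
  obtain ⟨C, c, hC, hc, hb⟩ := hp
  refine ⟨|K| * (C * (2 + 2 / c)), c / 2, by positivity, by positivity, fun z => ?_⟩
  calc ‖q z‖ ≤ K * ((1 + ‖z‖) * ‖p z‖) := h z
    _ ≤ |K| * ((1 + ‖z‖) * (C * Real.exp (-c * ‖z‖ ^ 2))) := by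
        gcongr
        · exact le_abs_self K
        · exact hb z
    _ = |K| * (C * ((1 + ‖z‖) * Real.exp (-c * ‖z‖ ^ 2))) := by ring
    _ ≤ |K| * (C * ((2 + 2 / c) * Real.exp (-(c / 2) * ‖z‖ ^ 2))) := by
        gcongr |K| * (C * ?_)
        exact one_add_mul_exp_neg_sq_le hc _
    _ = _ := by ring

lemma GaussDecay.one_add_norm_mul {p : V → G} (hp : GaussDecay p) :
    GaussDecay fun z => (1 + ‖z‖) * ‖p z‖ :=
  hp.of_norm_le (K := 1) fun z => by
    rw [norm_mul, norm_norm, Real.norm_of_nonneg (by positivity)]; simp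

lemma GaussDecay.exp_neg {c : ℝ} (hc : 0 < c) :
    GaussDecay fun z : V => Real.exp (-c * ‖z‖ ^ 2) :=
  ⟨1, c, zero_le_one, hc, fun z => by simp⟩

variable [InnerProductSpace ℝ V] [FiniteDimensional ℝ V] [MeasurableSpace V] [BorelSpace V]

lemma GaussDecay.integrable {q : V → F} (hq : GaussDecay q)
    (hm : AEStronglyMeasurable q volume) : Integrable q := by
  obtain ⟨C, c, hC, hc, hb⟩ := hq
  have h1 := (GaussianFourier.integrable_cexp_neg_mul_sq_norm_add (V := V) (b := (c : ℂ))
    (by simpa using hc) 0 0).norm.const_mul C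
  refine h1.mono' hm (ae_of_all _ fun z => (hb z).trans (le_of_eq ?_))
  simp [Complex.norm_exp, ← Complex.ofReal_pow]

end GaussianDecay

section ShiftDilate

variable {V : Type*} [NormedAddCommGroup V] [NormedSpace ℝ V]

/-- The derivative of `(m, r) ↦ r ^ n * q (r • (y - m)) * η`. -/
def shiftDilateDeriv (n : ℕ) (q : V → ℝ) (q' : V → V →L[ℝ] ℝ) (y : V) (η : ℝ) (p : V × ℝ) :
    V × ℝ →L[ℝ] ℝ :=
  (η * (n * p.2 ^ (n - 1) * q (p.2 • (y - p.1)))) • ContinuousLinearMap.snd ℝ V ℝ +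
    (η * p.2 ^ n) • (q' (p.2 • (y - p.1))).comp
      ((ContinuousLinearMap.snd ℝ V ℝ).smulRight (y - p.1) -
        p.2 • ContinuousLinearMap.fst ℝ V ℝ)

lemma hasFDerivAt_shiftDilate (n : ℕ) {q : V → ℝ} {q' : V → V →L[ℝ] ℝ}
    (hq : ∀ z, HasFDerivAt q (q' z) z) (y : V) (η : ℝ) (p : V × ℝ) :
    HasFDerivAt (fun p : V × ℝ => p.2 ^ n * q (p.2 • (y - p.1)) * η)
      (shiftDilateDeriv n q q' y η p) p := by
  have h1 : HasFDerivAt (fun p : V × ℝ => p.2 • (y - p.1)) _ p :=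
    (hasFDerivAt_snd (𝕜 := ℝ) (E := V) (F := ℝ)).smul
      ((hasFDerivAt_fst (𝕜 := ℝ) (E := V) (F := ℝ)).const_sub y)
  have h2 := (hq _).comp p h1
  have h3 : HasFDerivAt (fun p : V × ℝ => p.2 ^ n) _ p :=
    (hasFDerivAt_snd (𝕜 := ℝ) (E := V) (F := ℝ)).pow n
  refine ((h3.mul h2).mul_const η).congr_fderiv ?_
  ext v
  all_goals simp [shiftDilateDeriv]
  all_goals ring

lemma norm_shiftDilateDeriv_le (n : ℕ) (q : V → ℝ) (q' : V → V →L[ℝ] ℝ) (y : V) (η : ℝ)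
    (p : V × ℝ) :
    ‖shiftDilateDeriv n q q' y η p‖ ≤
      |η| * (n * |p.2| ^ (n - 1) * |q (p.2 • (y - p.1))|) +
      |η| * |p.2| ^ n * (‖q' (p.2 • (y - p.1))‖ * (‖y - p.1‖ + |p.2|)) := by
  unfold shiftDilateDeriv
  have h1 := ContinuousLinearMap.norm_fst_le (𝕜 := ℝ) (E := V) (F := ℝ)
  have h2 := ContinuousLinearMap.norm_snd_le (𝕜 := ℝ) (E := V) (F := ℝ)
  refine (norm_add_le _ _).trans (add_le_add ?_ ?_)
  · rw [norm_smul, norm_mul, norm_mul, norm_mul, norm_pow]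
    simp only [Real.norm_eq_abs, Nat.abs_cast]
    exact mul_le_of_le_one_right (by positivity) h2
  · rw [norm_smul, norm_mul, norm_pow]
    simp only [Real.norm_eq_abs]
    gcongr
    refine (ContinuousLinearMap.opNorm_comp_le _ _).trans ?_
    gcongr
    refine (norm_sub_le _ _).trans (add_le_add ?_ ?_)
    · rw [ContinuousLinearMap.norm_smulRight_apply]
      exact mul_le_of_le_one_left (by positivity) h2
    · rw [norm_smul]
      exact mul_le_of_le_one_right (by positivity) h1

lemma continuous_shiftDilateDeriv (n : ℕ) {q : V → ℝ} {q' : V → V →L[ℝ] ℝ}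
    (hq : Continuous q) (hq' : Continuous q') {h : V → ℝ} (hh : Continuous h) (p : V × ℝ) :
    Continuous fun y => shiftDilateDeriv n q q' y (h y) p := by
  have h1 : Continuous fun y : V => (ContinuousLinearMap.snd ℝ V ℝ).smulRight (y - p.1) :=
    (ContinuousLinearMap.smulRightL ℝ (V × ℝ) V (ContinuousLinearMap.snd ℝ V ℝ)).continuous.comp
      (continuous_id.sub continuous_const)
  have h2 : Continuous fun y : V => (q' (p.2 • (y - p.1))).comp
      ((ContinuousLinearMap.snd ℝ V ℝ).smulRight (y - p.1) -
        p.2 • ContinuousLinearMap.fst ℝ V ℝ) :=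
    Continuous.clm_comp (by fun_prop) (Continuous.sub h1 continuous_const)
  unfold shiftDilateDeriv
  fun_prop

/-- Gaussian domination, locally uniform in the shift and dilation parameters. -/
lemma exists_exp_shiftDilate_le {c r₀ : ℝ} (hc : 0 < c) (hr : 0 < r₀) (R : ℝ) :
    ∃ K c' : ℝ, 0 ≤ K ∧ 0 < c' ∧ ∀ (y m : V) (r : ℝ), ‖m‖ ≤ R → r₀ ≤ r →
      Real.exp (-c * ‖r • (y - m)‖ ^ 2) ≤ K * Real.exp (-c' * ‖y‖ ^ 2) := by
  refine ⟨Real.exp (c * r₀ ^ 2 * R ^ 2), c * r₀ ^ 2 / 2, by positivity, by positivity,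
    fun y m r hm hrr => ?_⟩
  rw [← Real.exp_add, Real.exp_le_exp, norm_smul, mul_pow, Real.norm_eq_abs, sq_abs]
  have h1 : ‖y‖ ^ 2 ≤ 2 * ‖y - m‖ ^ 2 + 2 * R ^ 2 := by
    have h2 : ‖y‖ ≤ ‖y - m‖ + R := by
      calc ‖y‖ = ‖(y - m) + m‖ := by simp
        _ ≤ _ := (norm_add_le _ _).trans (by gcongr)
    nlinarith [sq_nonneg (‖y - m‖ - R), norm_nonneg y, norm_nonneg (y - m), norm_nonneg m]
  have h3 : r₀ ^ 2 ≤ r ^ 2 := by gcongr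
  have h4 : c * r₀ ^ 2 * ‖y - m‖ ^ 2 ≤ c * (r ^ 2 * ‖y - m‖ ^ 2) := by
    rw [mul_assoc]; gcongr
  have h5 : c * r₀ ^ 2 * ‖y‖ ^ 2 ≤ c * r₀ ^ 2 * (2 * ‖y - m‖ ^ 2 + 2 * R ^ 2) := by gcongr
  linarith

lemma GaussDecay.shiftDilate {F : Type*} [NormedAddCommGroup F] {q : V → F} (hq : GaussDecay q)
    {r₀ : ℝ} (hr : 0 < r₀) (R : ℝ) :
    ∃ g : V → ℝ, Continuous g ∧ GaussDecay g ∧ (∀ y, 0 ≤ g y) ∧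
      ∀ (y m : V) (r : ℝ), ‖m‖ ≤ R → r₀ ≤ r → ‖q (r • (y - m))‖ ≤ g y := by
  obtain ⟨C, c, hC, hc, hb⟩ := hq
  obtain ⟨K, c', hK, hc', H⟩ := exists_exp_shiftDilate_le (V := V) hc hr R
  refine ⟨fun y => C * (K * Real.exp (-c' * ‖y‖ ^ 2)), by fun_prop,
    ⟨C * K, c', by positivity, hc', fun z => ?_⟩, fun y => by positivity,
    fun y m r hm hr => (hb _).trans ?_⟩
  · rw [Real.norm_of_nonneg (by positivity), mul_assoc]
  · exact mul_le_mul_of_nonneg_left (H y m r hm hr) hC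

end ShiftDilate

section ShiftDilateIntegral

variable {V : Type*} [NormedAddCommGroup V] [InnerProductSpace ℝ V]
variable [FiniteDimensional ℝ V] [MeasurableSpace V] [BorelSpace V]

/-- Shortcut instance, not found by unification through the inner product structure. -/
noncomputable instance instNormedAddCommGroupDualProd : NormedAddCommGroup (V × ℝ →L[ℝ] ℝ) :=
  ContinuousLinearMap.toNormedAddCommGroup

lemma GaussDecay.integrable_growth_smul {F : Type*} [NormedAddCommGroup F] [NormedSpace ℝ F]
    {q : V → F} (hq : GaussDecay q)
    (hqc : Continuous q) {h : V → ℝ} (hh : Continuous h) {A : ℝ}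
    (hA : ∀ y, |h y| ≤ A * (1 + ‖y‖)) : Integrable fun z => h z • q z := by
  refine (hq.of_norm_le (K := A) fun z => ?_).integrable (hh.smul hqc).aestronglyMeasurable
  rw [norm_smul, ← mul_assoc]
  gcongr
  exact hA z

lemma hasFDerivAt_integral_shiftDilate {q : V → ℝ} {q' : V → V →L[ℝ] ℝ}
    (hq : ∀ z, HasFDerivAt q (q' z) z) (hqc' : Continuous q') (hd : GaussDecay q)
    (hd' : GaussDecay q') {h : V → ℝ} (hh : Continuous h) {A : ℝ}
    (hA : ∀ y, |h y| ≤ A * (1 + ‖y‖)) (n : ℕ) (m₀ : V) {r₀ : ℝ} (hr : 0 < r₀) :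
    Integrable (fun y => shiftDilateDeriv n q q' y (h y) (m₀, r₀)) ∧
    HasFDerivAt (fun p : V × ℝ => ∫ y, p.2 ^ n * q (p.2 • (y - p.1)) * h y)
      (∫ y, shiftDilateDeriv n q q' y (h y) (m₀, r₀)) (m₀, r₀) := by
  have hqc : Continuous q := continuous_iff_continuousAt.2 fun z => (hq z).continuousAt
  have hA0 : 0 ≤ A := by simpa using (abs_nonneg _).trans (hA 0)
  set R := ‖m₀‖ + r₀ / 2
  set r₁ := 2 * r₀
  obtain ⟨g, hg, hgd, hg0, hgb⟩ := hd.shiftDilate (half_pos hr) R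
  obtain ⟨g', hg', hgd', hg0', hgb'⟩ := hd'.shiftDilate (half_pos hr) R
  have hR : 0 ≤ R := by positivity
  have hr1 : 0 < r₁ := by positivity
  let bd : V → ℝ := fun y => A * (1 + ‖y‖) * (n * r₁ ^ (n - 1) * g y) +
      A * (1 + ‖y‖) * r₁ ^ n * (g' y * (‖y‖ + R + r₁))
  have hbd : Integrable bd := by
    refine Integrable.add ?_ ?_
    · refine (hgd.of_norm_le (K := A * (n * r₁ ^ (n - 1))) fun y => ?_).integrable
        (Continuous.aestronglyMeasurable (by fun_prop))
      have := hg0 y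
      rw [Real.norm_of_nonneg (by positivity), Real.norm_of_nonneg (by positivity)]
      exact le_of_eq (by ring)
    · refine (hgd'.one_add_norm_mul.of_norm_le (K := A * r₁ ^ n * (1 + R + r₁))
        fun y => ?_).integrable (Continuous.aestronglyMeasurable (by fun_prop))
      have := hg0' y
      rw [Real.norm_of_nonneg (by positivity), Real.norm_of_nonneg (by positivity),
        Real.norm_of_nonneg (by positivity)]
      have : ‖y‖ + R + r₁ ≤ (1 + R + r₁) * (1 + ‖y‖) := by nlinarith [norm_nonneg y]
      calc A * (1 + ‖y‖) * r₁ ^ n * (g' y * (‖y‖ + R + r₁))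
          ≤ A * (1 + ‖y‖) * r₁ ^ n * (g' y * ((1 + R + r₁) * (1 + ‖y‖))) := by gcongr
        _ = _ := by ring
  have hball : ∀ p ∈ Metric.ball (m₀, r₀) (r₀ / 2), ∀ y,
      ‖shiftDilateDeriv n q q' y (h y) p‖ ≤ bd y := by
    intro p hp y
    rw [Metric.mem_ball, Prod.dist_eq, max_lt_iff, dist_eq_norm, Real.dist_eq, abs_lt] at hp
    obtain ⟨hp1, hp2, hp3⟩ := hp
    have hm : ‖p.1‖ ≤ R := by
      calc ‖p.1‖ = ‖m₀ + (p.1 - m₀)‖ := by simp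
        _ ≤ ‖m₀‖ + ‖p.1 - m₀‖ := norm_add_le _ _
        _ ≤ ‖m₀‖ + r₀ / 2 := by linarith
    have hp2' : r₀ / 2 ≤ p.2 := by linarith
    have hp0 : 0 ≤ p.2 := by linarith
    have hp3' : p.2 ≤ r₁ := by simp only [r₁]; linarith
    refine (norm_shiftDilateDeriv_le n q q' y (h y) p).trans ?_
    rw [abs_of_nonneg hp0]
    have e1 := hgb y p.1 p.2 hm hp2'
    have e2 := hgb' y p.1 p.2 hm hp2'
    have e3 := hA y
    have e4 : ‖y - p.1‖ ≤ ‖y‖ + R := (norm_sub_le _ _).trans (by linarith)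
    have e5 := hg0 y
    have e6 := hg0' y
    rw [Real.norm_eq_abs] at e1
    simp only [bd]
    gcongr
  refine ⟨hbd.mono' (continuous_shiftDilateDeriv n hqc hqc' hh _).aestronglyMeasurable
    (ae_of_all _ fun y => hball _ (Metric.mem_ball_self (by positivity)) y), ?_⟩
  refine hasFDerivAt_integral_of_dominated_of_fderiv_le (bound := bd)
    (Metric.ball_mem_nhds _ (half_pos hr)) (Eventually.of_forall fun p => ?_) ?_
    (continuous_shiftDilateDeriv n hqc hqc' hh _).aestronglyMeasurable
    (ae_of_all _ fun y p hp => hball p hp y) hbd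
    (ae_of_all _ fun y p _ => hasFDerivAt_shiftDilate n hq y (h y) p)
  · exact Continuous.aestronglyMeasurable (by fun_prop)
  · have := (hgd.integrable_growth_smul hg hh hA).norm.const_mul (r₀ ^ n)
    refine this.mono' (Continuous.aestronglyMeasurable (by fun_prop)) (ae_of_all _ fun y => ?_)
    have e1 := hgb y m₀ r₀ (by simp only [R]; linarith) (by linarith)
    rw [norm_mul, norm_mul, norm_pow, Real.norm_of_nonneg hr.le, norm_smul,
      Real.norm_of_nonneg (hg0 y), mul_assoc, mul_comm ‖h y‖]
    gcongr

end ShiftDilateIntegral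

section Weights

variable {V : Type*} [NormedAddCommGroup V] [NormedSpace ℝ V]

/-- `h` is continuous and has at most linear growth. -/
def LinearGrowth (h : V → ℝ) : Prop :=
  Continuous h ∧ ∃ A : ℝ, ∀ y, |h y| ≤ A * (1 + ‖y‖)

/-- `q` is continuously differentiable with derivative `q'`, both having Gaussian decay. -/
structure IsGaussWeight (q : V → ℝ) (q' : V → V →L[ℝ] ℝ) : Prop where
  hasFDerivAt : ∀ z, HasFDerivAt q (q' z) z
  continuous_deriv : Continuous q'
  decay : GaussDecay q
  decay_deriv : GaussDecay q'

lemma IsGaussWeight.continuous {q : V → ℝ} {q' : V → V →L[ℝ] ℝ} (hq : IsGaussWeight q q') :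
    Continuous q :=
  continuous_iff_continuousAt.2 fun z => (hq.hasFDerivAt z).continuousAt

lemma LinearGrowth.comp_affine {h : V → ℝ} (hh : LinearGrowth h) (m : V) (b : ℝ) :
    LinearGrowth fun z => h (m + b • z) := by
  obtain ⟨hc, A, hA⟩ := hh
  refine ⟨by fun_prop, |A| * (1 + ‖m‖ + |b|), fun y => (hA _).trans ?_⟩
  have h1 : ‖m + b • y‖ ≤ ‖m‖ + |b| * ‖y‖ := by
    refine (norm_add_le _ _).trans ?_
    rw [norm_smul, Real.norm_eq_abs]
  calc A * (1 + ‖m + b • y‖) ≤ |A| * (1 + (‖m‖ + |b| * ‖y‖)) := by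
        gcongr
        exact le_abs_self A
    _ ≤ |A| * ((1 + ‖m‖ + |b|) * (1 + ‖y‖)) := by
        gcongr
        nlinarith [norm_nonneg m, norm_nonneg y, abs_nonneg b,
          mul_nonneg (norm_nonneg m) (norm_nonneg y)]
    _ = _ := by ring

end Weights

section GaussAvg

variable {V : Type*} [NormedAddCommGroup V] [InnerProductSpace ℝ V]
variable [FiniteDimensional ℝ V] [MeasurableSpace V] [BorelSpace V]
variable {F : Type*} [NormedAddCommGroup F] [NormedSpace ℝ F]

lemma integral_comp_shiftDilate (G : V → F) (m : V) {r : ℝ} (hr : 0 < r) :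
    ∫ y, G (r • (y - m)) = (r ^ Module.finrank ℝ V)⁻¹ • ∫ z, G z := by
  rw [integral_sub_right_eq_self (fun y => G (r • y)) m, Measure.integral_comp_smul,
    abs_of_nonneg (by positivity)]

/-- The weighted Ornstein-Uhlenbeck average `∫ h (√t x + √(1 - t) z) Q(z) dz`. -/
noncomputable def gaussAvg (h : V → ℝ) (Q : V → F) (t : ℝ) (x : V) : F :=
  ∫ z, h (Real.sqrt t • x + Real.sqrt (1 - t) • z) • Q z

lemma gaussAvg_eq_integral_shiftDilate (h q : V → ℝ) {t : ℝ} (ht : t < 1) (x : V) :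
    gaussAvg h q t x = ∫ y, (Real.sqrt (1 - t))⁻¹ ^ Module.finrank ℝ V *
      q ((Real.sqrt (1 - t))⁻¹ • (y - Real.sqrt t • x)) * h y := by
  have hb : 0 < Real.sqrt (1 - t) := Real.sqrt_pos.2 (by linarith)
  have key := integral_comp_shiftDilate
    (fun z => h (Real.sqrt t • x + Real.sqrt (1 - t) • z) • q z) (Real.sqrt t • x)
    (inv_pos.2 hb)
  simp only [smul_smul, mul_inv_cancel₀ hb.ne', one_smul, add_sub_cancel] at key
  simp_rw [mul_assoc]
  rw [integral_const_mul]
  unfold gaussAvg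
  have h2 : ∀ y, q ((Real.sqrt (1 - t))⁻¹ • (y - Real.sqrt t • x)) * h y =
      h y • q ((Real.sqrt (1 - t))⁻¹ • (y - Real.sqrt t • x)) := fun y => by
    rw [smul_eq_mul, mul_comm]
  simp_rw [h2, key]
  rw [smul_eq_mul, mul_inv_cancel_left₀]
  positivity

lemma LinearGrowth.integrable_smul {h : V → ℝ} (hh : LinearGrowth h) {Q : V → F}
    (hQ : GaussDecay Q) (hQc : Continuous Q) : Integrable fun z => h z • Q z := by
  obtain ⟨hc, A, hA⟩ := hh
  exact hQ.integrable_growth_smul hQc hc hA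

lemma integrable_gaussAvg {h : V → ℝ} (hh : LinearGrowth h) {Q : V → F}
    (hQ : GaussDecay Q) (hQc : Continuous Q) (t : ℝ) (x : V) :
    Integrable fun z => h (Real.sqrt t • x + Real.sqrt (1 - t) • z) • Q z :=
  (hh.comp_affine _ _).integrable_smul hQ hQc

lemma integral_shiftDilateDeriv_apply {h q : V → ℝ} {q' : V → V →L[ℝ] ℝ}
    {m : V} {r : ℝ} (hr : 0 < r)
    (hi : Integrable fun y => shiftDilateDeriv (Module.finrank ℝ V) q q' y (h y) (m, r))
    (v : V) (ρ : ℝ) :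
    (∫ y, shiftDilateDeriv (Module.finrank ℝ V) q q' y (h y) (m, r)) (v, ρ) =
      ∫ z, h (m + r⁻¹ • z) *
        (ρ / r * (Module.finrank ℝ V * q z + q' z z) - r * q' z v) := by
  rw [ContinuousLinearMap.integral_apply hi]
  have key := integral_comp_shiftDilate (fun z => h (m + r⁻¹ • z) *
        (ρ / r * (Module.finrank ℝ V * q z + q' z z) - r * q' z v)) m hr
  rw [← smul_right_inj (pow_pos hr (Module.finrank ℝ V)).ne', smul_smul,
    mul_inv_cancel₀ (by positivity), one_smul, ← integral_smul] at key
  rw [← key]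
  refine integral_congr_ae (ae_of_all _ fun y => ?_)
  simp only [shiftDilateDeriv, smul_smul, inv_mul_cancel₀ hr.ne', one_smul, add_sub_cancel]
  simp only [smul_eq_mul, _root_.add_apply, _root_.smul_apply,
    ContinuousLinearMap.comp_apply, _root_.sub_apply, ContinuousLinearMap.coe_snd',
    ContinuousLinearMap.coe_fst', ContinuousLinearMap.smulRight_apply, map_sub, map_smul]
  rcases Nat.eq_zero_or_pos (Module.finrank ℝ V) with h0 | h0
  · simp only [h0]; field_simp; simp; ring
  · obtain ⟨k, hk⟩ := Nat.exists_eq_succ_of_ne_zero h0.ne'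
    rw [hk, Nat.succ_sub_one, pow_succ]
    field_simp
    ring

lemma hasFDerivAt_gaussAvg {h q : V → ℝ} {q' : V → V →L[ℝ] ℝ} (hh : LinearGrowth h)
    (hq : IsGaussWeight q q') {t : ℝ} (ht : t < 1) (x : V) :
    HasFDerivAt (fun x => gaussAvg h q t x)
      (-(Real.sqrt t / Real.sqrt (1 - t)) • gaussAvg h q' t x) x := by
  obtain ⟨hc, A, hA⟩ := hh
  have hb : 0 < Real.sqrt (1 - t) := Real.sqrt_pos.2 (by linarith)
  have hb' := inv_pos.2 hb
  obtain ⟨hi, hD⟩ := hasFDerivAt_integral_shiftDilate hq.hasFDerivAt hq.continuous_deriv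
    hq.decay hq.decay_deriv hc hA (Module.finrank ℝ V) (Real.sqrt t • x) hb'
  have hcv : HasFDerivAt (fun x : V => (Real.sqrt t • x, (Real.sqrt (1 - t))⁻¹))
      ((Real.sqrt t • ContinuousLinearMap.id ℝ V).prod 0) x :=
    ((hasFDerivAt_id x).const_smul _).prodMk (hasFDerivAt_const _ _)
  have hcomp := HasFDerivAt.comp x hD hcv
  simp_rw [gaussAvg_eq_integral_shiftDilate h q ht]
  refine hcomp.congr_fderiv ?_
  ext v
  have hi2 := integrable_gaussAvg ⟨hc, A, hA⟩ hq.decay_deriv hq.continuous_deriv t x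
  simp only [ContinuousLinearMap.comp_apply, ContinuousLinearMap.prod_apply,
    _root_.smul_apply, ContinuousLinearMap.id_apply, _root_.zero_apply]
  rw [integral_shiftDilateDeriv_apply hb' hi, gaussAvg, ContinuousLinearMap.integral_apply hi2,
    smul_eq_mul, ← integral_const_mul]
  refine integral_congr_ae (ae_of_all _ fun z => ?_)
  simp only [inv_inv, map_smul, smul_eq_mul, _root_.smul_apply]
  field_simp
  ring

lemma hasDerivAt_gaussAvg {h q : V → ℝ} {q' : V → V →L[ℝ] ℝ} (hh : LinearGrowth h)
    (hq : IsGaussWeight q q') {t : ℝ} (ht : t ∈ Ioo (0 : ℝ) 1) (x : V) :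
    HasDerivAt (fun t => gaussAvg h q t x)
      (∫ z, h (Real.sqrt t • x + Real.sqrt (1 - t) • z) *
        (1 / (2 * (1 - t)) * (Module.finrank ℝ V * q z + q' z z) -
          1 / (2 * Real.sqrt t * Real.sqrt (1 - t)) * q' z x)) t := by
  obtain ⟨hc, A, hA⟩ := hh
  obtain ⟨ht0, ht1⟩ := ht
  have h1t : 0 < 1 - t := by linarith
  have hb : 0 < Real.sqrt (1 - t) := Real.sqrt_pos.2 h1t
  have ha : 0 < Real.sqrt t := Real.sqrt_pos.2 ht0
  have hb' := inv_pos.2 hb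
  obtain ⟨hi, hD⟩ := hasFDerivAt_integral_shiftDilate hq.hasFDerivAt hq.continuous_deriv
    hq.decay hq.decay_deriv hc hA (Module.finrank ℝ V) (Real.sqrt t • x) hb'
  have hs : HasDerivAt (fun t => (Real.sqrt (1 - t))⁻¹) (1 / (2 * Real.sqrt (1 - t) ^ 3)) t := by
    have := (((hasDerivAt_id t).const_sub 1).sqrt h1t.ne').inv hb.ne'
    refine this.congr_deriv ?_
    simp only [id]
    field_simp
  have hcv : HasDerivAt (fun t => (Real.sqrt t • x, (Real.sqrt (1 - t))⁻¹))
      ((1 / (2 * Real.sqrt t)) • x, 1 / (2 * Real.sqrt (1 - t) ^ 3)) t :=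
    ((Real.hasDerivAt_sqrt ht0.ne').smul_const x).prodMk hs
  have hcomp := HasFDerivAt.comp_hasDerivAt t hD hcv
  rw [integral_shiftDilateDeriv_apply hb' hi] at hcomp
  refine (hcomp.congr_deriv ?_).congr_of_eventuallyEq ?_
  · refine integral_congr_ae (ae_of_all _ fun z => ?_)
    simp only [inv_inv, map_smul, smul_eq_mul]
    have hsq : 1 - t = Real.sqrt (1 - t) ^ 2 := (Real.sq_sqrt h1t.le).symm
    congr 2
    · congr 1
      conv_rhs => rw [hsq]
      field_simp
    · field_simp
  · filter_upwards [Iio_mem_nhds ht1] with s hs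
    exact gaussAvg_eq_integral_shiftDilate h q hs x

lemma IsGaussWeight.integral_deriv_eq_zero {q : V → ℝ} {q' : V → V →L[ℝ] ℝ}
    (hq : IsGaussWeight q q') : ∫ z, q' z = 0 := by
  have h1 : LinearGrowth fun _ : V => (1 : ℝ) :=
    ⟨continuous_const, 1, fun y => by simp⟩
  have h2 := hasFDerivAt_gaussAvg h1 hq (t := 1 / 2) (by norm_num) 0
  have h3 := h2.unique (by simpa [gaussAvg] using hasFDerivAt_const (∫ z, q z) (0 : V))
  have h4 : Real.sqrt (1 / 2) ≠ 0 := (Real.sqrt_pos.2 (by norm_num)).ne'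
  have h5 : (1 : ℝ) - 1 / 2 = 1 / 2 := by norm_num
  rw [h5] at h3
  simpa [gaussAvg, h4] using h3

lemma continuousOn_gaussAvg {h : V → ℝ} (hh : LinearGrowth h) {Q : V → F}
    (hQ : GaussDecay Q) (hQc : Continuous Q) (x : V) :
    ContinuousOn (fun t => gaussAvg h Q t x) (Icc 0 1) := by
  obtain ⟨hc, A, hA⟩ := hh
  have hA0 : 0 ≤ A := by simpa using (abs_nonneg _).trans (hA 0)
  refine continuousOn_of_dominated
    (bound := fun z => A * (1 + ‖x‖) * ((1 + ‖z‖) * ‖Q z‖)) (fun t _ => ?_)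
    (fun t ht => ae_of_all _ fun z => ?_) ?_ (ae_of_all _ fun z => ?_)
  · exact Continuous.aestronglyMeasurable (by fun_prop)
  · rw [norm_smul, ← mul_assoc]
    gcongr
    refine (hA _).trans ?_
    rw [mul_assoc]
    gcongr
    have h1 : Real.sqrt t ≤ 1 := Real.sqrt_le_one.2 ht.2
    have h2 : Real.sqrt (1 - t) ≤ 1 := Real.sqrt_le_one.2 (by linarith [ht.1])
    have h3 : ‖Real.sqrt t • x + Real.sqrt (1 - t) • z‖ ≤ ‖x‖ + ‖z‖ := by
      refine (norm_add_le _ _).trans ?_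
      rw [norm_smul, norm_smul, Real.norm_of_nonneg (Real.sqrt_nonneg _),
        Real.norm_of_nonneg (Real.sqrt_nonneg _)]
      gcongr
      · exact mul_le_of_le_one_left (norm_nonneg _) h1
      · exact mul_le_of_le_one_left (norm_nonneg _) h2
    nlinarith [norm_nonneg x, norm_nonneg z]
  · exact (hQ.one_add_norm_mul.integrable
      (Continuous.aestronglyMeasurable (by fun_prop))).const_mul _
  · exact Continuous.continuousOn (by fun_prop)

end GaussAvg

section Holder

lemma rpow_le_one_add {s α : ℝ} (hs : 0 ≤ s) (hα : α ∈ Ioc (0 : ℝ) 1) : s ^ α ≤ 1 + s := by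
  calc s ^ α ≤ (1 + s) ^ α := Real.rpow_le_rpow hs (by linarith) hα.1.le
    _ ≤ (1 + s) ^ (1 : ℝ) := Real.rpow_le_rpow_of_exponent_le (by linarith) hα.2
    _ = 1 + s := Real.rpow_one _

lemma integrableOn_Ioo_one_sub_rpow {s : ℝ} (hs : -1 < s) :
    IntegrableOn (fun t : ℝ => (1 - t) ^ s) (Ioo 0 1) := by
  have h1 : IntervalIntegrable (fun t : ℝ => t ^ s) volume 0 1 :=
    intervalIntegral.intervalIntegrable_rpow' hs
  have h2 := (h1.comp_sub_left 1).symm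
  rw [sub_zero, sub_self, intervalIntegrable_iff_integrableOn_Ioo_of_le zero_le_one] at h2
  exact h2

variable {V : Type*} [NormedAddCommGroup V] {h : V → ℝ} {α C : ℝ}

lemma linearGrowth_of_holder (hα : α ∈ Ioc (0 : ℝ) 1)
    (hh : ∀ x y, |h x - h y| ≤ C * dist x y ^ α) : LinearGrowth h := by
  refine ⟨continuous_iff_continuousAt.2 fun x => ?_, |h 0| + |C|, fun y => ?_⟩
  · refine tendsto_iff_dist_tendsto_zero.2 ?_
    refine squeeze_zero (fun _ => dist_nonneg) (fun y => hh y x) ?_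
    have h1 : Continuous fun y : V => C * dist y x ^ α :=
      continuous_const.mul ((continuous_id.dist continuous_const).rpow_const
        fun _ => Or.inr hα.1.le)
    have h2 := h1.tendsto x
    rwa [dist_self, Real.zero_rpow hα.1.ne', mul_zero] at h2
  · have h1 := hh y 0
    rw [dist_zero_right] at h1
    have h2 := rpow_le_one_add (norm_nonneg y) hα
    have h3 : C * ‖y‖ ^ α ≤ |C| * (1 + ‖y‖) := by
      gcongr
      exact le_abs_self C
    have h4 : |h y| ≤ |h y - h 0| + |h 0| := by
      simpa using abs_add_le (h y - h 0) (h 0)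
    nlinarith [norm_nonneg y, abs_nonneg (h 0), mul_nonneg (abs_nonneg (h 0)) (norm_nonneg y)]

variable [InnerProductSpace ℝ V] [FiniteDimensional ℝ V] [MeasurableSpace V] [BorelSpace V]
variable {F : Type*} [NormedAddCommGroup F] [NormedSpace ℝ F]

lemma exists_norm_gaussAvg_le (hα : α ∈ Ioc (0 : ℝ) 1)
    (hh : ∀ x y, |h x - h y| ≤ C * dist x y ^ α) {Q : V → F} (hQ : GaussDecay Q)
    (hQc : Continuous Q) (hQ0 : ∫ z, Q z = 0) :
    ∃ M : ℝ, 0 ≤ M ∧ ∀ t x, ‖gaussAvg h Q t x‖ ≤ M * Real.sqrt (1 - t) ^ α := by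
  have hL := linearGrowth_of_holder hα hh
  refine ⟨∫ z, |C| * (‖z‖ ^ α * ‖Q z‖),
    integral_nonneg fun z => by positivity, fun t x => ?_⟩
  have hb := Real.sqrt_nonneg (1 - t)
  have h1 : gaussAvg h Q t x = ∫ z, (h (Real.sqrt t • x + Real.sqrt (1 - t) • z) -
      h (Real.sqrt t • x)) • Q z := by
    have hi : Integrable fun z => h (Real.sqrt t • x) • Q z :=
      (hQ.integrable hQc.aestronglyMeasurable).smul _
    simp_rw [sub_smul]
    rw [integral_sub (integrable_gaussAvg hL hQ hQc t x) hi, integral_smul, hQ0, smul_zero,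
      sub_zero, gaussAvg]
  rw [h1, mul_comm, ← integral_const_mul]
  have hi : Integrable fun z => ‖z‖ ^ α * ‖Q z‖ := by
    refine (hQ.of_norm_le (K := 1) fun z => ?_).integrable ?_
    · rw [norm_mul, norm_norm, Real.norm_of_nonneg (by positivity), one_mul]
      gcongr
      exact rpow_le_one_add (norm_nonneg z) hα
    · exact ((continuous_norm.rpow_const fun _ => Or.inr hα.1.le).mul
        hQc.norm).aestronglyMeasurable
  refine norm_integral_le_of_norm_le ((hi.const_mul _).const_mul _) (ae_of_all _ fun z => ?_)
  have h2 := hh (Real.sqrt t • x + Real.sqrt (1 - t) • z) (Real.sqrt t • x)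
  rw [dist_eq_norm, add_sub_cancel_left, norm_smul, Real.norm_of_nonneg hb,
    Real.mul_rpow hb (norm_nonneg z)] at h2
  rw [norm_smul]
  calc _ ≤ C * (Real.sqrt (1 - t) ^ α * ‖z‖ ^ α) * ‖Q z‖ := by gcongr; exact h2
    _ ≤ |C| * (Real.sqrt (1 - t) ^ α * ‖z‖ ^ α) * ‖Q z‖ := by gcongr; exact le_abs_self C
    _ = _ := by ring

lemma exists_abs_gaussAvg_sub_le (hα : α ∈ Ioc (0 : ℝ) 1)
    (hh : ∀ x y, |h x - h y| ≤ C * dist x y ^ α) {q : V → ℝ} (hq : GaussDecay q)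
    (hqc : Continuous q) (x : V) :
    ∃ M : ℝ, 0 ≤ M ∧ ∀ t ∈ Icc (0 : ℝ) 1,
      |gaussAvg h q t x - ∫ z, h z * q z| ≤ M * Real.sqrt t ^ α := by
  have hL := linearGrowth_of_holder hα hh
  refine ⟨∫ z, |C| * ((‖x‖ + ‖z‖) ^ α * ‖q z‖),
    integral_nonneg fun z => by positivity, fun t ht => ?_⟩
  have ha := Real.sqrt_nonneg t
  have h1 : gaussAvg h q t x - ∫ z, h z * q z =
      ∫ z, (h (Real.sqrt t • x + Real.sqrt (1 - t) • z) - h z) * q z := by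
    simp_rw [sub_mul]
    exact (integral_sub (integrable_gaussAvg hL hq hqc t x) (hL.integrable_smul hq hqc)).symm
  rw [h1, mul_comm, ← integral_const_mul, ← Real.norm_eq_abs]
  have hi : Integrable fun z => (‖x‖ + ‖z‖) ^ α * ‖q z‖ := by
    refine (hq.of_norm_le (K := 1 + ‖x‖) fun z => ?_).integrable ?_
    · rw [norm_mul, norm_norm, Real.norm_of_nonneg (by positivity), ← mul_assoc]
      gcongr
      refine (rpow_le_one_add (by positivity) hα).trans ?_
      nlinarith [norm_nonneg x, norm_nonneg z, mul_nonneg (norm_nonneg x) (norm_nonneg z)]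
    · exact (((continuous_const.add continuous_norm).rpow_const fun _ => Or.inr hα.1.le).mul
        hqc.norm).aestronglyMeasurable
  refine norm_integral_le_of_norm_le ((hi.const_mul _).const_mul _) (ae_of_all _ fun z => ?_)
  have hb1 : Real.sqrt (1 - t) ≤ 1 := Real.sqrt_le_one.2 (by linarith [ht.1])
  have hb2 : 1 - Real.sqrt (1 - t) ≤ Real.sqrt t := by
    have e1 := Real.sq_sqrt ht.1
    have e2 := Real.sq_sqrt (show 0 ≤ 1 - t by linarith [ht.2])
    nlinarith [Real.sqrt_nonneg (1 - t), mul_nonneg ha (Real.sqrt_nonneg (1 - t))]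
  have h2 : dist (Real.sqrt t • x + Real.sqrt (1 - t) • z) z ≤ Real.sqrt t * (‖x‖ + ‖z‖) := by
    have e : Real.sqrt t • x + Real.sqrt (1 - t) • z - z =
        Real.sqrt t • x - (1 - Real.sqrt (1 - t)) • z := by module
    rw [dist_eq_norm, e, mul_add]
    refine (norm_sub_le _ _).trans ?_
    rw [norm_smul, norm_smul, Real.norm_of_nonneg ha, Real.norm_of_nonneg (by linarith)]
    gcongr
  rw [norm_mul]
  calc _ ≤ C * dist (Real.sqrt t • x + Real.sqrt (1 - t) • z) z ^ α * ‖q z‖ := by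
        gcongr; exact hh _ _
    _ ≤ |C| * (Real.sqrt t * (‖x‖ + ‖z‖)) ^ α * ‖q z‖ := by
        gcongr
        · exact le_abs_self C
        · exact hα.1.le
    _ = _ := by rw [Real.mul_rpow ha (by positivity)]; ring

lemma stronglyMeasurable_gaussAvg (hh : Continuous h) {Q : V → F} (hQc : Continuous Q) (x : V) :
    StronglyMeasurable fun t => gaussAvg h Q t x := by
  have h1 : Continuous fun p : ℝ × V =>
      h (Real.sqrt p.1 • x + Real.sqrt (1 - p.1) • p.2) • Q p.2 := by fun_prop
  exact h1.stronglyMeasurable.integral_prod_right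

/-- Differentiation under the time integral of weighted Ornstein-Uhlenbeck averages. -/
lemma hasFDerivAt_integral_gaussAvg (hα : α ∈ Ioc (0 : ℝ) 1)
    (hh : ∀ x y, |h x - h y| ≤ C * dist x y ^ α) {q : V → ℝ} {q' : V → V →L[ℝ] ℝ}
    (hq : IsGaussWeight q q') {w : ℝ → ℝ} (hw : Measurable w) (c : ℝ) (x : V)
    (hint : IntegrableOn (fun t => w t * (gaussAvg h q t x - c)) (Ioo 0 1))
    (hbd : IntegrableOn
      (fun t => w t * (Real.sqrt t / Real.sqrt (1 - t)) * Real.sqrt (1 - t) ^ α) (Ioo 0 1)) :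
    IntegrableOn (fun t => (w t * (Real.sqrt t / Real.sqrt (1 - t))) • gaussAvg h q' t x)
      (Ioo 0 1) ∧
    HasFDerivAt (fun x => ∫ t in Ioo (0 : ℝ) 1, w t * (gaussAvg h q t x - c))
      (-∫ t in Ioo (0 : ℝ) 1,
        (w t * (Real.sqrt t / Real.sqrt (1 - t))) • gaussAvg h q' t x) x := by
  have hL := linearGrowth_of_holder hα hh
  obtain ⟨M, hM, hMb⟩ := exists_norm_gaussAvg_le hα hh hq.decay_deriv hq.continuous_deriv
    hq.integral_deriv_eq_zero
  have hwm : Measurable fun t => w t * (Real.sqrt t / Real.sqrt (1 - t)) := by fun_prop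
  have hmeas : ∀ x, AEStronglyMeasurable
      (fun t => (w t * (Real.sqrt t / Real.sqrt (1 - t))) • gaussAvg h q' t x)
      (volume.restrict (Ioo 0 1)) := fun x =>
    (hwm.stronglyMeasurable.smul
      (stronglyMeasurable_gaussAvg hL.1 hq.continuous_deriv x)).aestronglyMeasurable
  have hle : ∀ t x, ‖(w t * (Real.sqrt t / Real.sqrt (1 - t))) • gaussAvg h q' t x‖ ≤
      M * ‖w t * (Real.sqrt t / Real.sqrt (1 - t)) * Real.sqrt (1 - t) ^ α‖ := fun t x => by
    rw [norm_smul, norm_mul (_ * _) (_ ^ _), Real.norm_of_nonneg (r := _ ^ α) (by positivity),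
      mul_left_comm]
    gcongr
    exact hMb t x
  have hbd' := hbd.norm.const_mul M
  refine ⟨hbd'.mono' (hmeas x) (ae_of_all _ fun t => hle t x), ?_⟩
  rw [← integral_neg]
  refine hasFDerivAt_integral_of_dominated_of_fderiv_le (s := univ)
    (F := fun x t => w t * (gaussAvg h q t x - c))
    (F' := fun x t => -((w t * (Real.sqrt t / Real.sqrt (1 - t))) • gaussAvg h q' t x))
    (bound := fun t => M * ‖w t * (Real.sqrt t / Real.sqrt (1 - t)) * Real.sqrt (1 - t) ^ α‖)
    univ_mem (Eventually.of_forall fun y => ?_) hint (hmeas x).neg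
    (ae_of_all _ fun t y _ => ?_) hbd' ?_
  · exact (hw.stronglyMeasurable.mul ((stronglyMeasurable_gaussAvg hL.1 hq.continuous y).sub
      stronglyMeasurable_const)).aestronglyMeasurable
  · rw [norm_neg]
    exact hle t y
  · filter_upwards [ae_restrict_mem measurableSet_Ioo] with t ht y _
    refine (((hasFDerivAt_gaussAvg hL hq ht.2 y).sub_const c).const_mul (w t)).congr_fderiv ?_
    module

end Holder

section GaussDensity

variable {V : Type*} [NormedAddCommGroup V] [InnerProductSpace ℝ V]

/-- The density of the standard Gaussian measure. -/
noncomputable def gaussDensity (z : V) : ℝ :=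
  ((2 * π) ^ (Module.finrank ℝ V / 2 : ℝ))⁻¹ * Real.exp (-(1 / 2) * ‖z‖ ^ 2)

/-- The derivative of `gaussDensity`. -/
noncomputable def gaussDensityDeriv (z : V) : V →L[ℝ] ℝ :=
  -gaussDensity z • innerSL ℝ z

/-- The derivative of `z ↦ gaussDensityDeriv z e`. -/
noncomputable def gaussDensityDeriv₂ (e z : V) : V →L[ℝ] ℝ :=
  gaussDensity z • (inner ℝ z e • innerSL ℝ z - innerSL ℝ e)

lemma continuous_gaussDensity : Continuous (gaussDensity (V := V)) := by
  unfold gaussDensity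
  fun_prop

lemma gaussDensity_nonneg (z : V) : 0 ≤ gaussDensity z := by
  unfold gaussDensity
  positivity

lemma hasFDerivAt_gaussDensity (z : V) :
    HasFDerivAt gaussDensity (gaussDensityDeriv z) z := by
  have h1 := (((hasStrictFDerivAt_norm_sq z).hasFDerivAt.const_mul (-(1 / 2) : ℝ)).exp).const_mul
    (((2 * π) ^ (Module.finrank ℝ V / 2 : ℝ))⁻¹)
  refine h1.congr_fderiv ?_
  ext v
  simp [gaussDensityDeriv, gaussDensity]
  ring

lemma hasFDerivAt_gaussDensityDeriv_apply (e z : V) :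
    HasFDerivAt (fun z => gaussDensityDeriv z e) (gaussDensityDeriv₂ e z) z := by
  have h1 : HasFDerivAt (fun z : V => inner ℝ e z) (innerSL ℝ e) z := (innerSL ℝ e).hasFDerivAt
  have h2 := ((hasFDerivAt_gaussDensity z).neg).mul h1
  refine (h2.congr_fderiv ?_).congr_of_eventuallyEq (Eventually.of_forall fun y => ?_)
  · ext v
    simp [gaussDensityDeriv, gaussDensityDeriv₂, real_inner_comm]
    ring
  · simp [gaussDensityDeriv, real_inner_comm]

lemma gaussDecay_gaussDensity : GaussDecay (gaussDensity (V := V)) :=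
  (GaussDecay.exp_neg (c := 1 / 2) (by norm_num)).of_norm_le
    (K := ((2 * π) ^ (Module.finrank ℝ V / 2 : ℝ))⁻¹) fun z => by
      rw [gaussDensity, norm_mul, Real.norm_of_nonneg (r := (_ ^ _)⁻¹) (by positivity)]
      gcongr
      exact le_mul_of_one_le_left (norm_nonneg _) (by linarith [norm_nonneg z])

lemma isGaussWeight_gaussDensity : IsGaussWeight (gaussDensity (V := V)) gaussDensityDeriv where
  hasFDerivAt := hasFDerivAt_gaussDensity
  continuous_deriv := by
    have := continuous_gaussDensity (V := V)
    unfold gaussDensityDeriv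
    fun_prop
  decay := gaussDecay_gaussDensity
  decay_deriv := gaussDecay_gaussDensity.of_norm_le (K := 1) fun z => by
    rw [gaussDensityDeriv, norm_smul, norm_neg, innerSL_apply_norm, one_mul, mul_comm]
    gcongr
    linarith

lemma isGaussWeight_gaussDensityDeriv_apply (e : V) :
    IsGaussWeight (fun z => gaussDensityDeriv z e) (gaussDensityDeriv₂ e) where
  hasFDerivAt := hasFDerivAt_gaussDensityDeriv_apply e
  continuous_deriv := by
    have := continuous_gaussDensity (V := V)
    unfold gaussDensityDeriv₂
    fun_prop
  decay := isGaussWeight_gaussDensity.decay_deriv.of_norm_le (K := ‖e‖) fun z => by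
    refine ((gaussDensityDeriv z).le_opNorm e).trans ?_
    rw [mul_comm]
    gcongr
    exact le_mul_of_one_le_left (norm_nonneg _) (by linarith [norm_nonneg z])
  decay_deriv := by
    refine gaussDecay_gaussDensity.one_add_norm_mul.of_norm_le (K := ‖e‖) fun z => ?_
    rw [gaussDensityDeriv₂, norm_smul, norm_mul, norm_norm,
      Real.norm_of_nonneg (r := 1 + ‖z‖) (by positivity)]
    have h1 : ‖inner ℝ z e • innerSL ℝ z - innerSL ℝ e‖ ≤ ‖e‖ * ((1 + ‖z‖) * (1 + ‖z‖)) := by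
      refine (norm_sub_le _ _).trans ?_
      rw [norm_smul, innerSL_apply_norm, innerSL_apply_norm]
      have := norm_inner_le_norm (𝕜 := ℝ) z e
      nlinarith [norm_nonneg z, norm_nonneg e, mul_nonneg (norm_nonneg z) (norm_nonneg e),
        mul_le_mul_of_nonneg_right this (norm_nonneg z)]
    calc _ ≤ ‖gaussDensity z‖ * (‖e‖ * ((1 + ‖z‖) * (1 + ‖z‖))) := by gcongr
      _ = _ := by ring

end GaussDensity

section Stein

lemma integral_gaussDensity_smul_cexp {d : ℕ} (s : EuclideanSpace ℝ (Fin d)) :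
    ∫ z, gaussDensity z • Complex.exp (inner ℝ z s * Complex.I) =
      Complex.exp (-‖s‖ ^ 2 / 2) := by
  have h1 := GaussianFourier.integral_cexp_neg_mul_sq_norm_add
    (V := EuclideanSpace ℝ (Fin d)) (b := 1 / 2) (by norm_num) Complex.I s
  simp only [finrank_euclideanSpace, Fintype.card_fin] at h1
  have h2 : ∀ z : EuclideanSpace ℝ (Fin d),
      gaussDensity z • Complex.exp (inner ℝ z s * Complex.I) =
      (((2 * π) ^ (d / 2 : ℝ))⁻¹ : ℝ) *
        Complex.exp (-(1 / 2) * ‖z‖ ^ 2 + Complex.I * inner ℝ s z) := fun z => by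
    rw [gaussDensity, Complex.real_smul, Complex.exp_add, real_inner_comm z s]
    simp only [finrank_euclideanSpace, Fintype.card_fin]
    push_cast
    ring_nf
  simp_rw [h2]
  rw [integral_const_mul, h1, ← mul_assoc]
  have h3 : ((((2 * π) ^ (d / 2 : ℝ))⁻¹ : ℝ) : ℂ) * ((π : ℂ) / (1 / 2)) ^ ((d : ℂ) / 2) = 1 := by
    have : ((π : ℂ) / (1 / 2)) ^ ((d : ℂ) / 2) = (((2 * π) ^ (d / 2 : ℝ) : ℝ) : ℂ) := by
      rw [Complex.ofReal_cpow (by positivity)]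
      push_cast
      congr 1
      ring
    rw [this, ← Complex.ofReal_mul, inv_mul_cancel₀ (by positivity), Complex.ofReal_one]
  rw [h3, one_mul]
  congr 1
  rw [Complex.I_sq]
  ring

lemma stdGaussian_eq_withDensity (d : ℕ) :
    _root_.stdGaussian d = volume.withDensity fun z => ENNReal.ofReal (gaussDensity z) := by
  have hm : Measurable fun z : EuclideanSpace ℝ (Fin d) => ENNReal.ofReal (gaussDensity z) :=
    continuous_gaussDensity.measurable.ennreal_ofReal
  have : IsFiniteMeasure ((volume : Measure (EuclideanSpace ℝ (Fin d))).withDensity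
      fun z => ENNReal.ofReal (gaussDensity z)) :=
    isFiniteMeasure_withDensity_ofReal (gaussDecay_gaussDensity.integrable
      continuous_gaussDensity.aestronglyMeasurable).2
  have h1 : _root_.stdGaussian d = ProbabilityTheory.stdGaussian (EuclideanSpace ℝ (Fin d)) :=
    map_pi_eq_stdGaussian
  rw [h1]
  refine Measure.ext_of_charFun ?_
  ext s
  rw [charFun_stdGaussian, charFun_apply,
    integral_withDensity_eq_integral_toReal_smul hm (by simp)]
  simp_rw [ENNReal.toReal_ofReal (gaussDensity_nonneg _)]
  rw [integral_gaussDensity_smul_cexp]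

lemma integral_stdGaussian {d : ℕ} (g : EuclideanSpace ℝ (Fin d) → ℝ) :
    ∫ z, g z ∂(_root_.stdGaussian d) = ∫ z, g z * gaussDensity z := by
  rw [stdGaussian_eq_withDensity, integral_withDensity_eq_integral_toReal_smul
    continuous_gaussDensity.measurable.ennreal_ofReal (by simp)]
  simp_rw [ENNReal.toReal_ofReal (gaussDensity_nonneg _), smul_eq_mul, mul_comm]

lemma integral_gaussDensity (d : ℕ) :
    ∫ z : EuclideanSpace ℝ (Fin d), gaussDensity z = 1 := by
  have h1 : _root_.stdGaussian d = ProbabilityTheory.stdGaussian (EuclideanSpace ℝ (Fin d)) :=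
    map_pi_eq_stdGaussian
  have h2 := integral_stdGaussian (d := d) fun _ => 1
  rw [h1] at h2
  simpa using h2.symm

lemma sum_gaussDensityDeriv₂ {d : ℕ} (z : EuclideanSpace ℝ (Fin d)) :
    ∑ j, gaussDensityDeriv₂ (EuclideanSpace.single j 1) z (EuclideanSpace.single j 1) =
      -(Module.finrank ℝ (EuclideanSpace ℝ (Fin d)) * gaussDensity z +
        gaussDensityDeriv z z) := by
  simp only [gaussDensityDeriv₂, gaussDensityDeriv, finrank_euclideanSpace, Fintype.card_fin]
  simp [EuclideanSpace.inner_single_right, ← Finset.mul_sum, Finset.sum_sub_distrib,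
    EuclideanSpace.real_norm_sq_eq, ← pow_two]
  ring

variable {d : ℕ} {h : EuclideanSpace ℝ (Fin d) → ℝ} {α C : ℝ}

lemma steinSol_eq (hL : LinearGrowth h) :
    steinSol d h = fun x => -∫ t in Ioo (0 : ℝ) 1,
      1 / (2 * t) * (gaussAvg h gaussDensity t x - ∫ z, h z * gaussDensity z) := by
  funext x
  unfold steinSol hbar
  congr 1
  refine integral_congr_ae (ae_of_all _ fun t => ?_)
  simp only [integral_stdGaussian]
  have hi := integrable_gaussAvg hL gaussDecay_gaussDensity continuous_gaussDensity t x
  simp only [smul_eq_mul] at hi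
  simp_rw [sub_mul]
  rw [integral_sub hi ((gaussDecay_gaussDensity.integrable
    continuous_gaussDensity.aestronglyMeasurable).const_mul _), integral_const_mul,
    integral_gaussDensity, mul_one, gaussAvg]
  simp_rw [smul_eq_mul]

lemma one_div_two_mul_mul_div_sqrt {t : ℝ} (ht : t ∈ Ioo (0 : ℝ) 1) :
    1 / (2 * t) * (Real.sqrt t / Real.sqrt (1 - t)) =
      1 / (2 * Real.sqrt t * Real.sqrt (1 - t)) := by
  have ha := Real.sqrt_pos.2 ht.1
  have hb := Real.sqrt_pos.2 (sub_pos.2 ht.2)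
  have e : 1 / (2 * t) = 1 / (2 * Real.sqrt t ^ 2) := by rw [Real.sq_sqrt ht.1.le]
  rw [e]
  field_simp

lemma one_div_sqrt_mul_mul_div_sqrt {t : ℝ} (ht : t ∈ Ioo (0 : ℝ) 1) :
    1 / (2 * Real.sqrt t * Real.sqrt (1 - t)) * (Real.sqrt t / Real.sqrt (1 - t)) =
      1 / (2 * (1 - t)) := by
  have ha := Real.sqrt_pos.2 ht.1
  have hb := Real.sqrt_pos.2 (sub_pos.2 ht.2)
  conv_rhs => rw [← Real.sq_sqrt (sub_pos.2 ht.2).le]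
  field_simp

lemma sqrt_rpow (t α : ℝ) (ht : 0 ≤ t) : Real.sqrt t ^ α = t ^ (α / 2) := by
  rw [Real.sqrt_eq_rpow, ← Real.rpow_mul ht]
  ring_nf

lemma integrableOn_stein_weight (hα : 0 < α) :
    IntegrableOn (fun t : ℝ => 1 / (2 * (1 - t)) * Real.sqrt (1 - t) ^ α) (Ioo 0 1) := by
  have h1 := (integrableOn_Ioo_one_sub_rpow (s := α / 2 - 1) (by linarith)).const_mul (1 / 2)
  refine IntegrableOn.congr_fun h1 (fun t ht => ?_) measurableSet_Ioo
  have hb : 0 < 1 - t := sub_pos.2 ht.2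
  rw [sqrt_rpow _ _ hb.le, Real.rpow_sub_one hb.ne']
  field_simp

lemma integrableOn_stein_weight_zero (hα : 0 < α) :
    IntegrableOn (fun t : ℝ => 1 / (2 * t) * Real.sqrt t ^ α) (Ioo 0 1) := by
  have h1 := ((intervalIntegral.integrableOn_Ioo_rpow_iff (s := α / 2 - 1) zero_lt_one).2
    (by linarith)).const_mul (1 / 2)
  refine IntegrableOn.congr_fun h1 (fun t ht => ?_) measurableSet_Ioo
  have hb : 0 < t := ht.1
  rw [sqrt_rpow _ _ hb.le, Real.rpow_sub_one hb.ne']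
  field_simp

lemma integrableOn_arcsine_weight (hα : 0 ≤ α) :
    IntegrableOn (fun t : ℝ =>
      1 / (2 * Real.sqrt t * Real.sqrt (1 - t)) * Real.sqrt (1 - t) ^ α) (Ioo 0 1) := by
  have h1 := ((integrableOn_stein_weight zero_lt_one).add
    (integrableOn_stein_weight_zero zero_lt_one))
  refine h1.mono' ?_ ?_
  · exact Measurable.aestronglyMeasurable (by fun_prop)
  · filter_upwards [ae_restrict_mem measurableSet_Ioo] with t ht
    have ha := Real.sqrt_pos.2 ht.1
    have hb := Real.sqrt_pos.2 (sub_pos.2 ht.2)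
    have ha2 := Real.sq_sqrt ht.1.le
    have hb2 := Real.sq_sqrt (sub_pos.2 ht.2).le
    have hle : Real.sqrt (1 - t) ^ α ≤ 1 :=
      Real.rpow_le_one hb.le (Real.sqrt_le_one.2 (by linarith [ht.1])) hα
    rw [Real.norm_of_nonneg (by positivity)]
    simp only [Pi.add_apply, Real.rpow_one]
    have e1 : 1 / (2 * t) * Real.sqrt t = 1 / (2 * Real.sqrt t) := by
      conv_lhs => rw [← ha2, Real.sqrt_sq ha.le]
      field_simp
    have e2 : 1 / (2 * (1 - t)) * Real.sqrt (1 - t) = 1 / (2 * Real.sqrt (1 - t)) := by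
      conv_lhs => rw [← hb2, Real.sqrt_sq hb.le]
      field_simp
    rw [e1, e2]
    calc _ ≤ 1 / (2 * Real.sqrt t * Real.sqrt (1 - t)) * 1 := by gcongr
      _ ≤ 1 / (2 * Real.sqrt t * Real.sqrt (1 - t)) * (Real.sqrt t + Real.sqrt (1 - t)) := by
        gcongr
        nlinarith [mul_pos ha hb]
      _ = _ := by field_simp

/-- The gradient of Barbour's solution. -/
lemma hasFDerivAt_steinSol (hα : α ∈ Ioc (0 : ℝ) 1)
    (hh : ∀ x y, |h x - h y| ≤ C * dist x y ^ α) (x : EuclideanSpace ℝ (Fin d)) :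
    IntegrableOn (fun t : ℝ => (1 / (2 * Real.sqrt t * Real.sqrt (1 - t))) •
      gaussAvg h gaussDensityDeriv t x) (Ioo 0 1) ∧
    HasFDerivAt (steinSol d h) (∫ t in Ioo (0 : ℝ) 1,
      (1 / (2 * Real.sqrt t * Real.sqrt (1 - t))) • gaussAvg h gaussDensityDeriv t x) x := by
  have hL := linearGrowth_of_holder hα hh
  obtain ⟨M, hM, hMb⟩ := exists_abs_gaussAvg_sub_le hα hh gaussDecay_gaussDensity
    continuous_gaussDensity x
  have hint : IntegrableOn (fun t => 1 / (2 * t) *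
      (gaussAvg h gaussDensity t x - ∫ z, h z * gaussDensity z)) (Ioo 0 1) := by
    refine ((integrableOn_stein_weight_zero hα.1).const_mul M).mono' ?_ ?_
    · exact ((by fun_prop : Measurable fun t : ℝ => 1 / (2 * t)).stronglyMeasurable.mul
        ((stronglyMeasurable_gaussAvg hL.1 continuous_gaussDensity x).sub
          stronglyMeasurable_const)).aestronglyMeasurable
    · filter_upwards [ae_restrict_mem measurableSet_Ioo] with t ht
      have ht0 := ht.1
      rw [norm_mul, Real.norm_of_nonneg (by positivity), mul_left_comm, Real.norm_eq_abs]
      gcongr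
      exact hMb t (Ioo_subset_Icc_self ht)
  have hbd : IntegrableOn (fun t : ℝ => 1 / (2 * t) * (Real.sqrt t / Real.sqrt (1 - t)) *
      Real.sqrt (1 - t) ^ α) (Ioo 0 1) :=
    (integrableOn_arcsine_weight hα.1.le).congr_fun
      (fun t ht => by simp only [one_div_two_mul_mul_div_sqrt ht]) measurableSet_Ioo
  obtain ⟨h1, h2⟩ := hasFDerivAt_integral_gaussAvg hα hh isGaussWeight_gaussDensity
    (w := fun t => 1 / (2 * t)) (by fun_prop) _ x hint hbd
  have e : EqOn (fun t : ℝ => (1 / (2 * t) * (Real.sqrt t / Real.sqrt (1 - t))) •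
      gaussAvg h gaussDensityDeriv t x) (fun t : ℝ =>
      (1 / (2 * Real.sqrt t * Real.sqrt (1 - t))) • gaussAvg h gaussDensityDeriv t x)
      (Ioo 0 1) := fun t ht => by simp only [one_div_two_mul_mul_div_sqrt ht]
  refine ⟨h1.congr_fun e measurableSet_Ioo, ?_⟩
  rw [steinSol_eq hL, ← setIntegral_congr_fun measurableSet_Ioo e]
  exact h2.neg.congr_fderiv (neg_neg _)

lemma gaussAvg_apply {V : Type*} [NormedAddCommGroup V] [InnerProductSpace ℝ V]
    [FiniteDimensional ℝ V] [MeasurableSpace V] [BorelSpace V] {h : V → ℝ}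
    (hL : LinearGrowth h) {Q : V → V →L[ℝ] ℝ} (hQ : GaussDecay Q)
    (hQc : Continuous Q) (t : ℝ) (x v : V) :
    gaussAvg h Q t x v = gaussAvg h (fun z => Q z v) t x := by
  rw [gaussAvg, ContinuousLinearMap.integral_apply (integrable_gaussAvg hL hQ hQc t x)]
  simp [gaussAvg]

lemma fderiv_steinSol_apply (hα : α ∈ Ioc (0 : ℝ) 1)
    (hh : ∀ x y, |h x - h y| ≤ C * dist x y ^ α) (x v : EuclideanSpace ℝ (Fin d)) :
    IntegrableOn (fun t : ℝ => 1 / (2 * Real.sqrt t * Real.sqrt (1 - t)) *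
      gaussAvg h (fun z => gaussDensityDeriv z v) t x) (Ioo 0 1) ∧
    fderiv ℝ (steinSol d h) x v = ∫ t in Ioo (0 : ℝ) 1,
      1 / (2 * Real.sqrt t * Real.sqrt (1 - t)) *
        gaussAvg h (fun z => gaussDensityDeriv z v) t x := by
  obtain ⟨h1, h2⟩ := hasFDerivAt_steinSol hα hh x
  have e : ∀ t, ((1 / (2 * Real.sqrt t * Real.sqrt (1 - t))) •
      gaussAvg h gaussDensityDeriv t x) v = 1 / (2 * Real.sqrt t * Real.sqrt (1 - t)) *
        gaussAvg h (fun z => gaussDensityDeriv z v) t x := fun t => by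
    rw [_root_.smul_apply, gaussAvg_apply (linearGrowth_of_holder hα hh)
      isGaussWeight_gaussDensity.decay_deriv isGaussWeight_gaussDensity.continuous_deriv,
      smul_eq_mul]
  rw [h2.fderiv, ContinuousLinearMap.integral_apply h1]
  simp_rw [← e]
  exact ⟨h1.apply_continuousLinearMap v, trivial⟩

lemma hessEntry_steinSol (hα : α ∈ Ioc (0 : ℝ) 1)
    (hh : ∀ x y, |h x - h y| ≤ C * dist x y ^ α) (x : EuclideanSpace ℝ (Fin d)) (i j : Fin d) :
    IntegrableOn (fun t : ℝ => 1 / (2 * (1 - t)) * gaussAvg h (fun z =>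
      gaussDensityDeriv₂ (EuclideanSpace.single j 1) z (EuclideanSpace.single i 1)) t x)
      (Ioo 0 1) ∧
    hessEntry (steinSol d h) x i j = -∫ t in Ioo (0 : ℝ) 1, 1 / (2 * (1 - t)) *
      gaussAvg h (fun z => gaussDensityDeriv₂ (EuclideanSpace.single j 1) z
        (EuclideanSpace.single i 1)) t x := by
  have hL := linearGrowth_of_holder hα hh
  have hW := isGaussWeight_gaussDensityDeriv_apply
    (EuclideanSpace.single j 1 : EuclideanSpace ℝ (Fin d))
  have hp : pderivI j (steinSol d h) = fun x => ∫ t in Ioo (0 : ℝ) 1,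
      1 / (2 * Real.sqrt t * Real.sqrt (1 - t)) *
        (gaussAvg h (fun z => gaussDensityDeriv z (EuclideanSpace.single j 1)) t x - 0) := by
    funext y
    simp only [sub_zero]
    exact (fderiv_steinSol_apply hα hh y _).2
  have hbd : IntegrableOn (fun t : ℝ => 1 / (2 * Real.sqrt t * Real.sqrt (1 - t)) *
      (Real.sqrt t / Real.sqrt (1 - t)) * Real.sqrt (1 - t) ^ α) (Ioo 0 1) :=
    (integrableOn_stein_weight hα.1).congr_fun
      (fun t ht => by simp only [one_div_sqrt_mul_mul_div_sqrt ht]) measurableSet_Ioo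
  obtain ⟨h1, h2⟩ := hasFDerivAt_integral_gaussAvg hα hh hW
    (w := fun t => 1 / (2 * Real.sqrt t * Real.sqrt (1 - t))) (by fun_prop) 0 x
    (by simpa only [sub_zero] using (fderiv_steinSol_apply hα hh x _).1) hbd
  have e : EqOn (fun t : ℝ => ((1 / (2 * Real.sqrt t * Real.sqrt (1 - t)) *
      (Real.sqrt t / Real.sqrt (1 - t))) • gaussAvg h
        (gaussDensityDeriv₂ (EuclideanSpace.single j 1)) t x) (EuclideanSpace.single i 1))
      (fun t : ℝ => 1 / (2 * (1 - t)) *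
      gaussAvg h (fun z => gaussDensityDeriv₂ (EuclideanSpace.single j 1) z
        (EuclideanSpace.single i 1)) t x) (Ioo 0 1) := fun t ht => by
    simp only [one_div_sqrt_mul_mul_div_sqrt ht]
    rw [_root_.smul_apply, gaussAvg_apply hL hW.decay_deriv hW.continuous_deriv, smul_eq_mul]
  refine ⟨IntegrableOn.congr_fun (h1.apply_continuousLinearMap _) e measurableSet_Ioo, ?_⟩
  rw [hessEntry, pderivI, hp, h2.fderiv, _root_.neg_apply,
    ContinuousLinearMap.integral_apply h1, setIntegral_congr_fun measurableSet_Ioo e]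

end Stein

/-- **Proposition 2.1, second part**: for `α`-Hölder `h`, Barbour's solution `f_h` solves the
multivariate Stein equation `Δ f_h(x) - x · ∇ f_h(x) = h(x) - E h(Z)`. -/
theorem steinSol_solves_stein_equation
    {d : ℕ} (hd : 1 ≤ d) {α : ℝ} (hα : α ∈ Set.Ioc (0 : ℝ) 1)
    (h : EuclideanSpace ℝ (Fin d) → ℝ) (hC : ∃ C : ℝ, HolderConst α C h) :
    ∀ x, laplacian (steinSol d h) x - fderiv ℝ (steinSol d h) x x =
      h x - ∫ z, h z ∂(stdGaussian d) := by
  intro x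
  obtain ⟨C, hh⟩ := hC
  have hL := linearGrowth_of_holder hα hh
  obtain ⟨hgi, hge⟩ := fderiv_steinSol_apply hα hh x x
  have hH := fun j => hessEntry_steinSol hα hh x j j
  have hsum := integrable_finsetSum Finset.univ fun j _ => (hH j).1
  rw [hge, laplacian, integral_stdGaussian]
  simp_rw [(hH _).2]
  rw [Finset.sum_neg_distrib, ← integral_finsetSum _ fun j _ => (hH j).1, ← neg_add',
    ← integral_add hsum hgi, ← integral_neg]
  have hderiv : ∀ t ∈ Ioo (0 : ℝ) 1, HasDerivAt (fun t => gaussAvg h gaussDensity t x)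
      (-(∑ j, 1 / (2 * (1 - t)) * gaussAvg h (fun z => gaussDensityDeriv₂
          (EuclideanSpace.single j 1) z (EuclideanSpace.single j 1)) t x +
        1 / (2 * Real.sqrt t * Real.sqrt (1 - t)) *
          gaussAvg h (fun z => gaussDensityDeriv z x) t x)) t := by
    intro t ht
    refine (hasDerivAt_gaussAvg hL isGaussWeight_gaussDensity ht x).congr_deriv ?_
    have hWx := isGaussWeight_gaussDensityDeriv_apply x
    have i1 := fun j : Fin d => ((integrable_gaussAvg hL
      (isGaussWeight_gaussDensityDeriv_apply (EuclideanSpace.single j 1)).decay_deriv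
      (isGaussWeight_gaussDensityDeriv_apply (EuclideanSpace.single j 1)).continuous_deriv
      t x).apply_continuousLinearMap (EuclideanSpace.single j 1)).const_mul (1 / (2 * (1 - t)))
    have i2 := (integrable_gaussAvg hL hWx.decay hWx.continuous t x).const_mul
      (1 / (2 * Real.sqrt t * Real.sqrt (1 - t)))
    simp only [_root_.smul_apply] at i1
    simp only [gaussAvg, ← integral_const_mul]
    rw [← integral_finsetSum _ fun j _ => i1 j,
      ← integral_add (integrable_finsetSum _ fun j _ => i1 j) i2, ← integral_neg]
    refine integral_congr_ae (ae_of_all _ fun z => ?_)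
    simp only [smul_eq_mul, ← Finset.mul_sum, sum_gaussDensityDeriv₂]
    ring
  have hint := (hsum.add hgi).neg
  have hftc := intervalIntegral.integral_eq_sub_of_hasDerivAt_of_le zero_le_one
    (continuousOn_gaussAvg hL gaussDecay_gaussDensity continuous_gaussDensity x) hderiv
    ((intervalIntegrable_iff_integrableOn_Ioo_of_le zero_le_one).2 hint)
  rw [intervalIntegral.integral_of_le zero_le_one, integral_Ioc_eq_integral_Ioo] at hftc
  rw [hftc]
  simp [gaussAvg, integral_const_mul, integral_gaussDensity]
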